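/- Let (V,‖·‖) be a finite-dimensional real normed vector space and let K ⊆ V be a closed convex cone with 0 ∈ K and K ≠ V. Then for every h ∈ K, dist(h, ∂K) = inf{ α(h) : α is a continuous linear functional on V with ‖α‖* = 1 and α(v) ≥ 0 for all v ∈ K }. In particular, for every ε > 0 and h ∈ K, dist(h, ∂K) ≥ ε‖h‖ holds if and only if α(h) ≥ ε‖h‖ for every norm-one continuous linear functional α that is nonnegative on K. -/

import Mathlib

theorem IsPreconnected.inter_frontier_nonempty {X : Type*} [TopologicalSpace X] {s t : Set X}
    (hs : IsPreconnected s) (hst : (s ∩ t).Nonempty) (hst' : (s ∩ tᶜ).Nonempty) :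
    (s ∩ frontier t).Nonempty := by
  by_contra hempty
  have hmem : ∀ x ∈ s, x ∈ interior t ∨ x ∈ interior tᶜ := by
    intro x hx
    by_contra! hxt
    refine hempty ⟨x, hx, ?_⟩
    rw [frontier_eq_inter_compl_interior]
    exact hxt
  obtain ⟨x, hx, hxt⟩ := hst
  obtain ⟨y, hy, hyt⟩ := hst'
  obtain ⟨z, -, hzt, hzt'⟩ := hs _ _ isOpen_interior isOpen_interior hmem
    ⟨x, hx, (hmem x hx).resolve_right fun h => interior_subset h hxt⟩
    ⟨y, hy, (hmem y hy).resolve_left fun h => hyt (interior_subset h)⟩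
  exact interior_subset hzt' (interior_subset hzt)

theorem exists_norm_one_nonneg_of_notMem_cone
    {V : Type*} [NormedAddCommGroup V] [NormedSpace ℝ V]
    {K : Set V} (hclosed : IsClosed K) (hconv : Convex ℝ K)
    (hcone : ∀ c : ℝ, 0 < c → ∀ v ∈ K, c • v ∈ K) (h0 : (0 : V) ∈ K)
    {w : V} (hw : w ∉ K) :
    ∃ α : V →L[ℝ] ℝ, ‖α‖ = 1 ∧ (∀ v ∈ K, 0 ≤ α v) ∧ α w < 0 := by
  obtain ⟨f, u, hfw, hfK⟩ := geometric_hahn_banach_point_closed hconv hclosed hw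
  have hu : u < 0 := by simpa using hfK 0 h0
  have hf : f ≠ 0 := by
    rintro rfl
    simp only [zero_apply] at hfw
    linarith
  have hn : 0 < ‖f‖ := norm_pos_iff.mpr hf
  have hpos : ∀ v ∈ K, 0 ≤ f v := by
    intro v hv
    by_contra! hneg
    have h := hfK _ (hcone (u / f v) (div_pos_of_neg_of_neg hu hneg) v hv)
    rw [map_smul, smul_eq_mul, div_mul_cancel₀ _ hneg.ne] at h
    exact lt_irrefl _ h
  refine ⟨‖f‖⁻¹ • f, ?_, fun v hv => ?_, ?_⟩
  · rw [norm_smul, norm_inv, norm_norm, inv_mul_cancel₀ hn.ne']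
  · exact mul_nonneg (inv_nonneg.mpr hn.le) (hpos v hv)
  · exact mul_neg_of_pos_of_neg (inv_pos.mpr hn) (hfw.trans hu)

theorem ball_infDist_frontier_subset
    {V : Type*} [NormedAddCommGroup V] [NormedSpace ℝ V] {K : Set V} {h : V} (hh : h ∈ K) :
    Metric.ball h (Metric.infDist h (frontier K)) ⊆ K := by
  intro y hy
  by_contra hyK
  have hpos : 0 < Metric.infDist h (frontier K) := dist_nonneg.trans_lt hy
  obtain ⟨z, hzb, hzf⟩ := (convex_ball h _).isPreconnected.inter_frontier_nonempty
    ⟨h, Metric.mem_ball_self hpos, hh⟩ ⟨y, hy, hyK⟩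
  have hle := Metric.infDist_le_dist_of_mem (x := h) hzf
  rw [Metric.mem_ball, dist_comm] at hzb
  exact absurd hzb hle.not_gt

theorem infDist_frontier_le_of_nonneg
    {V : Type*} [NormedAddCommGroup V] [NormedSpace ℝ V] {K : Set V} {h : V} (hh : h ∈ K)
    {α : V →L[ℝ] ℝ} (hα : ‖α‖ = 1) (hnonneg : ∀ v ∈ K, 0 ≤ α v) :
    Metric.infDist h (frontier K) ≤ α h := by
  by_contra! hlt
  set d := Metric.infDist h (frontier K) with hd
  have hd0 : 0 < d := (hnonneg h hh).trans_lt hlt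
  obtain ⟨x, hx1, hx⟩ := α.exists_lt_apply_of_lt_opNorm
    (show α h / d < ‖α‖ by rwa [hα, div_lt_one hd0])
  obtain ⟨y, hy1, hy⟩ : ∃ y : V, ‖y‖ < 1 ∧ α h / d < α y := by
    rcases abs_choice (α x) with hc | hc
    · exact ⟨x, hx1, by rwa [Real.norm_eq_abs, hc] at hx⟩
    · exact ⟨-x, by rwa [norm_neg], by rwa [Real.norm_eq_abs, hc, ← map_neg] at hx⟩
  have hmem : h - d • y ∈ K := by
    apply ball_infDist_frontier_subset hh
    rw [← hd, mem_ball_iff_norm, sub_sub_cancel_left, norm_neg, norm_smul, Real.norm_eq_abs,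
      abs_of_pos hd0]
    exact mul_lt_of_lt_one_right hd0 hy1
  have hval := hnonneg _ hmem
  rw [map_sub, map_smul, smul_eq_mul] at hval
  rw [div_lt_iff₀ hd0] at hy
  linarith

/-- For a closed convex cone `K ≠ V` containing `0` in a finite-dimensional real normed
vector space, `dist(h, ∂K)` equals the infimum of `α(h)` over norm-one continuous linear
functionals `α` that are nonnegative on `K`; in particular `dist(h, ∂K) ≥ ε‖h‖` iff
`α(h) ≥ ε‖h‖` for all such `α`. -/
theorem dist_frontier_eq_inf_dual
    {V : Type*} [NormedAddCommGroup V] [NormedSpace ℝ V] [FiniteDimensional ℝ V]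
    (K : Set V) (hclosed : IsClosed K) (hconv : Convex ℝ K)
    (hcone : ∀ c : ℝ, 0 < c → ∀ v ∈ K, c • v ∈ K)
    (h0 : (0 : V) ∈ K) (hKuniv : K ≠ Set.univ) :
    (∀ h ∈ K, Metric.infDist h (frontier K) =
      sInf {x : ℝ | ∃ α : V →L[ℝ] ℝ, ‖α‖ = 1 ∧ (∀ v ∈ K, 0 ≤ α v) ∧ α h = x}) ∧
    (∀ ε : ℝ, 0 < ε → ∀ h ∈ K,
      (ε * ‖h‖ ≤ Metric.infDist h (frontier K) ↔
        ∀ α : V →L[ℝ] ℝ, ‖α‖ = 1 → (∀ v ∈ K, 0 ≤ α v) → ε * ‖h‖ ≤ α h)) := by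
  obtain ⟨w₀, hw₀⟩ := (Set.ne_univ_iff_exists_notMem K).mp hKuniv
  have hbdd : ∀ h ∈ K, BddBelow
      {x : ℝ | ∃ α : V →L[ℝ] ℝ, ‖α‖ = 1 ∧ (∀ v ∈ K, 0 ≤ α v) ∧ α h = x} := by
    rintro h hh
    refine ⟨0, ?_⟩
    rintro x ⟨α, -, hα, rfl⟩
    exact hα h hh
  have hnonempty : ∀ h : V,
      {x : ℝ | ∃ α : V →L[ℝ] ℝ, ‖α‖ = 1 ∧ (∀ v ∈ K, 0 ≤ α v) ∧ α h = x}.Nonempty := by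
    intro h
    obtain ⟨α, hα1, hα, -⟩ := exists_norm_one_nonneg_of_notMem_cone hclosed hconv hcone h0 hw₀
    exact ⟨α h, α, hα1, hα, rfl⟩
  have heq : ∀ h ∈ K, Metric.infDist h (frontier K) =
      sInf {x : ℝ | ∃ α : V →L[ℝ] ℝ, ‖α‖ = 1 ∧ (∀ v ∈ K, 0 ≤ α v) ∧ α h = x} := by
    intro h hh
    apply le_antisymm
    · apply le_csInf (hnonempty h)
      rintro x ⟨α, hα1, hα, rfl⟩
      exact infDist_frontier_le_of_nonneg hh hα1 hα
    · refine le_of_forall_pos_lt_add fun δ hδ => ?_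
      have hfr : (frontier K).Nonempty := nonempty_frontier_iff.mpr ⟨⟨0, h0⟩, hKuniv⟩
      obtain ⟨p, hp, hhp⟩ := (Metric.infDist_lt_iff hfr).mp
        (lt_add_of_pos_right (Metric.infDist h (frontier K)) (half_pos hδ))
      rw [frontier_eq_closure_inter_closure] at hp
      obtain ⟨w, hw, hpw⟩ := Metric.mem_closure_iff.mp hp.2 (δ / 2) (half_pos hδ)
      obtain ⟨α, hα1, hα, hαw⟩ := exists_norm_one_nonneg_of_notMem_cone hclosed hconv hcone h0 hw
      have hle := csInf_le (hbdd h hh) ⟨α, hα1, hα, rfl⟩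
      have hnorm : α (h - w) ≤ dist h w := by
        have := (le_abs_self _).trans (α.le_opNorm (h - w))
        rwa [hα1, one_mul, ← dist_eq_norm] at this
      rw [map_sub] at hnorm
      linarith [dist_triangle h p w]
  refine ⟨heq, fun ε _ h hh => ?_⟩
  rw [heq h hh, le_csInf_iff (hbdd h hh) (hnonempty h)]
  constructor
  · intro H α hα1 hα
    exact H _ ⟨α, hα1, hα, rfl⟩
  · rintro H x ⟨α, hα1, hα, rfl⟩
    exact H α hα1 hα
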